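/- arXiv:2112.13685 — 2 statements merged into one kernel-verified Lean document; each statement's English description precedes it below -/
import Mathlib

section
/- (Springer) Let ζ ∈ ℂ be a root of unity, and let w, w' ∈ W. Suppose there exist v, v' ∈ V_reg with w(v) = ζ·v and w'(v') = ζ·v'. Then w and w' are conjugate in W. (In particular, for each d ≥ 1 and each primitive d-th root of unity ζ_d, a ζ_d-regular element of W, if it exists, is unique up to W-conjugacy.) -/
open Module

noncomputable section

variable {V : Type*} [AddCommGroup V] [Module ℂ V] [FiniteDimensional ℂ V]

/-- `g` is a reflection: its fixed-point subspace has codimension 1. -/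
def IsReflection (g : V ≃ₗ[ℂ] V) : Prop :=
  finrank ℂ (LinearMap.ker ((g : V →ₗ[ℂ] V) - LinearMap.id)) + 1 = finrank ℂ V

/-- The set of points of `V` with trivial stabilizer in `W`. -/
def VReg (W : Subgroup (V ≃ₗ[ℂ] V)) : Set V :=
  {v | ∀ w ∈ W, w v = v → w = 1}

/-! ### Polynomial functions in the coordinates of a basis -/

section PolynomialFunctions

open MvPolynomial

variable {U : Type*} [AddCommGroup U] [Module ℂ U] {ι : Type*} [Fintype ι] (b : Basis ι ℂ U)

/-- Evaluation of a polynomial in the coordinates at a vector. -/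
def evalAt (x : U) : MvPolynomial ι ℂ →ₐ[ℂ] ℂ := aeval (fun i => b.coord i x)

/-- Precomposition of polynomial functions with an endomorphism. -/
def pullback (L : U →ₗ[ℂ] U) : MvPolynomial ι ℂ →ₐ[ℂ] MvPolynomial ι ℂ :=
  aeval (fun i => ∑ j, C (b.coord i (L (b j))) * X j)

/-- The polynomial of degree one attached to a linear form. -/
def linearPoly (φ : U →ₗ[ℂ] ℂ) : MvPolynomial ι ℂ := ∑ j, C (φ (b j)) * X j

theorem evalAt_linearPoly (φ : U →ₗ[ℂ] ℂ) (x : U) : evalAt b x (linearPoly b φ) = φ x := by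
  conv_rhs => rw [← b.sum_repr x, map_sum]
  simp [evalAt, linearPoly, mul_comm]

theorem evalAt_pullback (L : U →ₗ[ℂ] U) (x : U) (f : MvPolynomial ι ℂ) :
    evalAt b x (pullback b L f) = evalAt b (L x) f := by
  have : (evalAt b x).comp (pullback b L) = evalAt b (L x) := by
    ext i
    have := evalAt_linearPoly b ((b.coord i).comp L) x
    simpa [pullback, evalAt, linearPoly] using this
  exact DFunLike.congr_fun this f

theorem evalAt_ext {f g : MvPolynomial ι ℂ} (h : ∀ x, evalAt b x f = evalAt b x g) : f = g := by
  refine MvPolynomial.funext fun x => ?_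
  have := h (b.equivFun.symm x)
  have hx : (fun i => b.coord i (b.equivFun.symm x)) = x := b.equivFun.apply_symm_apply x
  simpa only [evalAt, hx, aeval_eq_eval] using this

theorem pullback_comp (L M : U →ₗ[ℂ] U) (f : MvPolynomial ι ℂ) :
    pullback b (L ∘ₗ M) f = pullback b M (pullback b L f) :=
  evalAt_ext b fun x => by simp [evalAt_pullback]

theorem pullback_id (f : MvPolynomial ι ℂ) : pullback b LinearMap.id f = f :=
  evalAt_ext b fun x => by simp [evalAt_pullback]

theorem pullback_pow (L : U →ₗ[ℂ] U) (n : ℕ) (f : MvPolynomial ι ℂ) :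
    pullback b (L ^ n) f = ((pullback b L).toLinearMap ^ n) f := by
  induction n generalizing f with
  | zero => exact pullback_id b f
  | succ n ih =>
    rw [pow_succ', Module.End.mul_eq_comp, pullback_comp, ih, pow_succ]
    rfl

theorem isHomogeneous_pullback (L : U →ₗ[ℂ] U) {f : MvPolynomial ι ℂ} {n : ℕ}
    (hf : f.IsHomogeneous n) : (pullback b L f).IsHomogeneous n := by
  have := hf.aeval (fun i => ∑ j, C (b.coord i (L (b j))) * X j : ι → MvPolynomial ι ℂ) (n := 1)
    (fun i => IsHomogeneous.sum _ _ _ fun j _ => isHomogeneous_C_mul_X _ _)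
  rwa [one_mul] at this

theorem pullback_homogeneousComponent (L : U →ₗ[ℂ] U) (n : ℕ) (f : MvPolynomial ι ℂ) :
    pullback b L (homogeneousComponent n f) = homogeneousComponent n (pullback b L f) := by
  conv_rhs => rw [← sum_homogeneousComponent f]
  rw [map_sum, map_sum]
  have h (i : ℕ) : homogeneousComponent n (pullback b L (homogeneousComponent i f)) =
      if n = i then pullback b L (homogeneousComponent n f) else 0 := by
    rw [homogeneousComponent_of_mem
      (isHomogeneous_pullback b L (homogeneousComponent_isHomogeneous i f))]
    split_ifs with hn
    · rw [hn]
    · rfl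
  simp only [h, Finset.sum_ite_eq, Finset.mem_range]
  split_ifs with hn
  · rfl
  · rw [homogeneousComponent_eq_zero _ _ (by omega), map_zero]

theorem totalDegree_pullback_le (L : U →ₗ[ℂ] U) (f : MvPolynomial ι ℂ) :
    (pullback b L f).totalDegree ≤ f.totalDegree := by
  conv_lhs => rw [← sum_homogeneousComponent f]
  rw [map_sum]
  refine totalDegree_finsetSum_le fun i hi => ?_
  have := (isHomogeneous_pullback b L (homogeneousComponent_isHomogeneous i f)).totalDegree_le
  have := Finset.mem_range.1 hi
  omega

/-- A polynomial and its pullback along a reflection with hyperplane `ker φ` agree modulo the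
linear polynomial of `φ`. -/
theorem exists_pullback_sub_eq {L : U →ₗ[ℂ] U} {φ : U →ₗ[ℂ] ℂ} {a : U}
    (hL : ∀ x, L x = x + φ x • a) (f : MvPolynomial ι ℂ) :
    ∃ q, f - pullback b L f = linearPoly b φ * q := by
  have h : (Ideal.Quotient.mkₐ ℂ (Ideal.span {linearPoly b φ})).comp (pullback b L) =
      Ideal.Quotient.mkₐ ℂ (Ideal.span {linearPoly b φ}) := by
    ext i
    have : pullback b L (X i) = X i + linearPoly b φ * C (b.coord i a) :=
      evalAt_ext b fun x => by
        rw [evalAt_pullback, map_add, map_mul, evalAt_linearPoly, hL]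
        simp [evalAt]
    simp only [AlgHom.comp_apply, this, map_add, map_mul, add_eq_left]
    rw [Ideal.Quotient.mkₐ_eq_mk, Ideal.Quotient.eq_zero_iff_mem.2
      (Ideal.mem_span_singleton_self _), zero_mul]
  have h' := DFunLike.congr_fun h f
  rw [AlgHom.comp_apply, eq_comm, Ideal.Quotient.mkₐ_eq_mk, Ideal.Quotient.eq,
    Ideal.mem_span_singleton] at h'
  exact h'

theorem totalDegree_lt_of_pullback_sub_eq {L : U →ₗ[ℂ] U} {φ : U →ₗ[ℂ] ℂ} (hφ : φ ≠ 0)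
    {f q : MvPolynomial ι ℂ} (h : f - pullback b L f = linearPoly b φ * q) (hq : q ≠ 0) :
    q.totalDegree < f.totalDegree := by
  have hl : linearPoly b φ ≠ 0 := by
    intro h0
    refine hφ (LinearMap.ext fun x => ?_)
    rw [← evalAt_linearPoly b, h0, map_zero, LinearMap.zero_apply]
  have h1 : (linearPoly b φ).IsHomogeneous 1 :=
    IsHomogeneous.sum _ _ _ fun j _ => isHomogeneous_C_mul_X _ _
  have h2 := totalDegree_mul_of_isDomain hl hq
  rw [h1.totalDegree hl, ← h] at h2
  have h3 := totalDegree_sub f (pullback b L f)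
  have h4 := totalDegree_pullback_le b L f
  rw [max_eq_left h4] at h3
  omega

/-- If an endomorphism has finite order, then its homogeneous eigenpolynomials span. -/
theorem span_eigenpolynomials_eq_top (L : U →ₗ[ℂ] U) {N : ℕ} (hN : 0 < N) (hL : L ^ N = 1) :
    Submodule.span ℂ {f : MvPolynomial ι ℂ |
      (∃ n, f.IsHomogeneous n) ∧ ∃ c : ℂ, pullback b L f = c • f} = ⊤ := by
  set E := {f : MvPolynomial ι ℂ | (∃ n, f.IsHomogeneous n) ∧ ∃ c : ℂ, pullback b L f = c • f}
  have key (n : ℕ) : homogeneousSubmodule ι ℂ n ≤ Submodule.span ℂ E := by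
    let M := homogeneousSubmodule ι ℂ n
    have : FiniteDimensional ℂ M := Module.Finite.iff_fg.2 (homogeneousSubmodule_fg ..)
    let T : End ℂ M := (pullback b L).toLinearMap.restrict
      fun f hf => isHomogeneous_pullback b L hf
    have hT (k : ℕ) (f : M) : ((T ^ k) f : MvPolynomial ι ℂ) = pullback b (L ^ k) f := by
      rw [pullback_pow]
      exact congrArg Subtype.val (LinearMap.congr_fun (Module.End.pow_restrict k _) f)
    have hs : T.IsSemisimple := by
      refine Module.End.isSemisimple_of_squarefree_aeval_eq_zero (p := Polynomial.X ^ N - 1)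
        (Polynomial.Separable.squarefree
          (Polynomial.X_pow_sub_one_separable_iff.2 (by exact_mod_cast hN.ne'))) ?_
      ext1 f
      apply Subtype.ext
      simp [hT, hL, Module.End.one_eq_id, pullback_id]
    intro f hf
    have htop : (⟨f, hf⟩ : M) ∈ ⨆ μ, T.eigenspace μ := by
      rw [hs.iSup_eigenspace_eq_top]; trivial
    have hle : (⨆ μ, T.eigenspace μ) ≤ (Submodule.span ℂ E).comap M.subtype := by
      refine iSup_le fun μ g hg => Submodule.subset_span ⟨⟨n, g.2⟩, μ, ?_⟩
      exact congrArg Subtype.val (Module.End.mem_eigenspace_iff.1 hg)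
    exact hle htop
  refine eq_top_iff.2 fun f _ => ?_
  rw [← sum_homogeneousComponent f]
  exact Submodule.sum_mem _ fun n _ => key n (homogeneousComponent_isHomogeneous n f)

/-! ### Invariants and the Hilbert ideal -/

/-- The subalgebra of polynomials invariant under `W`. -/
def polyInvariants (W : Subgroup (U ≃ₗ[ℂ] U)) : Subalgebra ℂ (MvPolynomial ι ℂ) where
  carrier := {f | ∀ g ∈ W, pullback b (g : U →ₗ[ℂ] U) f = f}
  mul_mem' hf hg w hw := by rw [map_mul, hf w hw, hg w hw]
  add_mem' hf hg w hw := by rw [map_add, hf w hw, hg w hw]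
  algebraMap_mem' c w _ := by rw [AlgHom.commutes]

/-- The ideal generated by the homogeneous invariants of positive degree. -/
def hilbertIdeal (W : Subgroup (U ≃ₗ[ℂ] U)) : Ideal (MvPolynomial ι ℂ) :=
  Ideal.span {a | a ∈ polyInvariants b W ∧ ∃ k, 0 < k ∧ a.IsHomogeneous k}

variable {b} {W : Subgroup (U ≃ₗ[ℂ] U)}

theorem pullback_mul (g h : U ≃ₗ[ℂ] U) (f : MvPolynomial ι ℂ) :
    pullback b ((g * h : U ≃ₗ[ℂ] U) : U →ₗ[ℂ] U) f =
      pullback b (h : U →ₗ[ℂ] U) (pullback b (g : U →ₗ[ℂ] U) f) :=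
  pullback_comp b _ _ f

theorem sub_C_constantCoeff_mem_hilbertIdeal {a : MvPolynomial ι ℂ}
    (ha : a ∈ polyInvariants b W) : a - C (constantCoeff a) ∈ hilbertIdeal b W := by
  have h : a - C (constantCoeff a) =
      ∑ i ∈ Finset.range a.totalDegree, homogeneousComponent (i + 1) a := by
    have := sum_homogeneousComponent a
    rw [Finset.sum_range_succ', homogeneousComponent_zero] at this
    exact sub_eq_iff_eq_add.2 this.symm
  rw [h]
  refine Ideal.sum_mem _ fun i _ => Ideal.subset_span ⟨fun g hg => ?_, i + 1, i.succ_pos,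
    homogeneousComponent_isHomogeneous _ _⟩
  rw [pullback_homogeneousComponent, ha g hg]

theorem pullback_mem_hilbertIdeal {g : U ≃ₗ[ℂ] U} (hg : g ∈ W) {f : MvPolynomial ι ℂ}
    (hf : f ∈ hilbertIdeal b W) : pullback b (g : U →ₗ[ℂ] U) f ∈ hilbertIdeal b W := by
  have : hilbertIdeal b W ≤ (hilbertIdeal b W).comap (pullback b (g : U →ₗ[ℂ] U)) := by
    refine Ideal.span_le.2 fun a ha => ?_
    rw [SetLike.mem_coe, Ideal.mem_comap, ha.1 g hg]
    exact Ideal.subset_span ha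
  exact this hf

theorem sum_pullback_mem_polyInvariants [Fintype W] (f : MvPolynomial ι ℂ) :
    ∑ g : W, pullback b ((g : U ≃ₗ[ℂ] U) : U →ₗ[ℂ] U) f ∈ polyInvariants b W := by
  intro h hh
  rw [map_sum]
  refine Fintype.sum_equiv (Equiv.mulRight (⟨h, hh⟩ : W)) _ _ fun g => ?_
  rw [Equiv.coe_mulRight, Subgroup.coe_mul, pullback_mul]

theorem prod_pullback_mem_polyInvariants [Fintype W] (f : MvPolynomial ι ℂ) :
    ∏ g : W, pullback b ((g : U ≃ₗ[ℂ] U) : U →ₗ[ℂ] U) f ∈ polyInvariants b W := by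
  intro h hh
  rw [map_prod]
  refine Fintype.prod_equiv (Equiv.mulRight (⟨h, hh⟩ : W)) _ _ fun g => ?_
  rw [Equiv.coe_mulRight, Subgroup.coe_mul, pullback_mul]

theorem sub_pullback_mem_hilbertIdeal {R : Set (U ≃ₗ[ℂ] U)} (hR : Subgroup.closure R = W)
    {f : MvPolynomial ι ℂ}
    (hf : ∀ r ∈ R, f - pullback b (r : U →ₗ[ℂ] U) f ∈ hilbertIdeal b W)
    {g : U ≃ₗ[ℂ] U} (hg : g ∈ W) : f - pullback b (g : U →ₗ[ℂ] U) f ∈ hilbertIdeal b W := by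
  rw [← hR] at hg
  induction hg using Subgroup.closure_induction with
  | mem r hr => exact hf r hr
  | one =>
    have : pullback b ((1 : U ≃ₗ[ℂ] U) : U →ₗ[ℂ] U) f = f := pullback_id b f
    rw [this, sub_self]
    exact zero_mem _
  | mul g h _ hh ihg ihh =>
    have := pullback_mem_hilbertIdeal (hR ▸ hh) ihg
    rw [map_sub, ← pullback_mul] at this
    simpa using add_mem ihh this
  | inv g hg ih =>
    have := pullback_mem_hilbertIdeal (inv_mem (hR ▸ hg)) ih
    rw [map_sub, ← pullback_mul, mul_inv_cancel] at this
    have h1 : pullback b ((1 : U ≃ₗ[ℂ] U) : U →ₗ[ℂ] U) f = f := pullback_id b f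
    rw [h1] at this
    simpa using neg_mem this

/-- Chevalley's lemma: if `a₀ f` lies in the ideal generated by invariants `a i`, then `f` lies in
the Hilbert ideal, unless `a₀` lies in the ideal of invariants generated by the `a i` locally at
the origin. -/
theorem mem_hilbertIdeal_of_mul_eq_sum [Finite W] {R : Set (U ≃ₗ[ℂ] U)}
    (hR : Subgroup.closure R = W)
    (hrefl : ∀ r ∈ R, ∃ φ : U →ₗ[ℂ] ℂ, φ ≠ 0 ∧ ∃ a, ∀ x, r x = x + φ x • a)
    {κ : Type*} [Fintype κ] {a₀ : MvPolynomial ι ℂ} {a : κ → MvPolynomial ι ℂ}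
    (ha₀ : a₀ ∈ polyInvariants b W) (ha : ∀ i, a i ∈ polyInvariants b W)
    (hloc : ∀ c ∈ polyInvariants b W, ∀ β : κ → MvPolynomial ι ℂ,
      (∀ i, β i ∈ polyInvariants b W) → c * a₀ = ∑ i, β i * a i → constantCoeff c = 0)
    (f : MvPolynomial ι ℂ) (t : κ → MvPolynomial ι ℂ) (h : a₀ * f = ∑ i, t i * a i) :
    f ∈ hilbertIdeal b W := by
  have := Fintype.ofFinite W
  induction hd : f.totalDegree using Nat.strong_induction_on generalizing f t with
  | _ d ih =>
  have hsub (r) (hr : r ∈ R) : f - pullback b (r : U →ₗ[ℂ] U) f ∈ hilbertIdeal b W := by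
    obtain ⟨φ, hφ, v, hv⟩ := hrefl r hr
    have hrW : r ∈ W := hR ▸ Subgroup.subset_closure hr
    obtain ⟨q, hq⟩ := exists_pullback_sub_eq b (L := (r : U →ₗ[ℂ] U)) hv f
    choose u hu using fun i => exists_pullback_sub_eq b (L := (r : U →ₗ[ℂ] U)) hv (t i)
    rw [hq]
    refine Ideal.mul_mem_left _ _ ?_
    rcases eq_or_ne q 0 with rfl | hq0
    · exact zero_mem _
    refine ih _ (hd ▸ totalDegree_lt_of_pullback_sub_eq b hφ hq hq0) q u ?_ rfl
    have hl : linearPoly b φ ≠ 0 := by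
      intro h0
      refine hφ (LinearMap.ext fun x => ?_)
      rw [← evalAt_linearPoly b, h0, map_zero, LinearMap.zero_apply]
    refine mul_left_cancel₀ hl ?_
    rw [mul_left_comm, ← hq, mul_sub, Finset.mul_sum]
    have h' := congrArg (pullback b (r : U →ₗ[ℂ] U)) h
    simp only [map_mul, map_sum, ha₀ r hrW, fun i => ha i r hrW] at h'
    rw [h, h', ← Finset.sum_sub_distrib]
    refine Finset.sum_congr rfl fun i _ => ?_
    rw [← mul_assoc, ← hu]
    ring
  set F := ∑ g : W, pullback b ((g : U ≃ₗ[ℂ] U) : U →ₗ[ℂ] U) f with hF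
  have hFinv : F ∈ polyInvariants b W := sum_pullback_mem_polyInvariants f
  have hF0 : constantCoeff F = 0 := by
    refine hloc F hFinv (fun i => ∑ g : W, pullback b ((g : U ≃ₗ[ℂ] U) : U →ₗ[ℂ] U) (t i))
      (fun i => sum_pullback_mem_polyInvariants _) ?_
    simp only [hF, Finset.sum_mul]
    rw [Finset.sum_comm]
    refine Finset.sum_congr rfl fun g _ => ?_
    have h' := congrArg (pullback b ((g : U ≃ₗ[ℂ] U) : U →ₗ[ℂ] U)) h
    simp only [map_mul, map_sum, ha₀ g g.2, fun i => ha i g g.2] at h'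
    rw [mul_comm, h']
  have hFI : F ∈ hilbertIdeal b W := by
    have := sub_C_constantCoeff_mem_hilbertIdeal hFinv
    rwa [hF0, C_0, sub_zero] at this
  have hdiff : ∑ g : W, (f - pullback b ((g : U ≃ₗ[ℂ] U) : U →ₗ[ℂ] U) f) ∈ hilbertIdeal b W :=
    Ideal.sum_mem _ fun g _ => sub_pullback_mem_hilbertIdeal hR hsub g.2
  rw [Finset.sum_sub_distrib, Finset.sum_const, Finset.card_univ, ← hF] at hdiff
  have hcard := add_mem hdiff hFI
  rw [sub_add_cancel, nsmul_eq_mul] at hcard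
  have := Ideal.mul_mem_left _ (C ((Fintype.card W : ℂ)⁻¹)) hcard
  rwa [← mul_assoc, ← map_natCast C, ← C_mul,
    inv_mul_cancel₀ (by exact_mod_cast Fintype.card_ne_zero), C_1, one_mul] at this

/-- Polynomials which are linearly independent modulo the Hilbert ideal of a reflection group are
linearly independent over the invariants. -/
theorem eq_zero_of_sum_mul_eq_zero [Finite W] {R : Set (U ≃ₗ[ℂ] U)}
    (hR : Subgroup.closure R = W)
    (hrefl : ∀ r ∈ R, ∃ φ : U →ₗ[ℂ] ℂ, φ ≠ 0 ∧ ∃ a, ∀ x, r x = x + φ x • a)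
    {k : ℕ} {e : Fin k → MvPolynomial ι ℂ}
    (he : LinearIndependent ℂ fun i => Ideal.Quotient.mkₐ ℂ (hilbertIdeal b W) (e i))
    {a : Fin k → MvPolynomial ι ℂ} (ha : ∀ i, a i ∈ polyInvariants b W)
    (h : ∑ i, a i * e i = 0) : a = 0 := by
  induction k with
  | zero => exact Subsingleton.elim _ _
  | succ k ih =>
  set π := Ideal.Quotient.mkₐ ℂ (hilbertIdeal b W)
  rw [Fin.sum_univ_succ] at h
  have hnot : e 0 ∉ hilbertIdeal b W := fun h0 =>
    he.ne_zero 0 (Ideal.Quotient.eq_zero_iff_mem.2 h0)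
  obtain ⟨c, hc, β, hβ, hcβ, hc0⟩ : ∃ c ∈ polyInvariants b W, ∃ β : Fin k → MvPolynomial ι ℂ,
      (∀ i, β i ∈ polyInvariants b W) ∧ c * a 0 = ∑ i, β i * a i.succ ∧
        constantCoeff c ≠ 0 := by
    by_contra hcon
    have hloc : ∀ c ∈ polyInvariants b W, ∀ β : Fin k → MvPolynomial ι ℂ,
      (∀ i, β i ∈ polyInvariants b W) → c * a 0 = ∑ i, β i * a i.succ → constantCoeff c = 0 :=
      fun c hc β hβ h' => by_contra fun h0 => hcon ⟨c, hc, β, hβ, h', h0⟩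
    have h0 : a 0 * e 0 = ∑ i : Fin k, -e i.succ * a i.succ := by
      simp only [neg_mul, Finset.sum_neg_distrib, mul_comm (e _)]
      exact eq_neg_of_add_eq_zero_left h
    exact hnot (mem_hilbertIdeal_of_mul_eq_sum (b := b) (κ := Fin k) (a₀ := a 0)
      (a := fun i => a i.succ) hR hrefl (ha 0) (fun i => ha i.succ) hloc (e 0)
      (fun i => -e i.succ) h0)
  have hπ (p) (hp : p ∈ polyInvariants b W) (f) : π (p * f) = constantCoeff p • π f := by
    rw [← map_smul, smul_eq_C_mul]
    refine Ideal.Quotient.eq.2 ?_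
    rw [← sub_mul]
    exact Ideal.mul_mem_right _ _ (sub_C_constantCoeff_mem_hilbertIdeal hp)
  have htail : (fun i => a (Fin.succ i)) = 0 := by
    refine ih (e := fun i => c * e i.succ + β i * e 0) ?_ (fun i => ha i.succ) ?_
    · rw [Fintype.linearIndependent_iff] at he ⊢
      intro x hx i
      have := he (Fin.cons (∑ i, x i * constantCoeff (β i)) fun i => x i * constantCoeff c) ?_
        i.succ
      · simpa [hc0] using this
      · rw [Fin.sum_univ_succ, ← hx]
        simp only [map_add, hπ _ hc, hπ _ (hβ _), smul_add, Finset.sum_add_distrib, Fin.cons_zero,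
          Fin.cons_succ, smul_smul, Finset.sum_smul]
        rw [add_comm]
    · have h2 := congrArg (c * ·) h
      simp only [mul_add, mul_zero, ← mul_assoc, hcβ, Finset.sum_mul, Finset.mul_sum,
        ← Finset.sum_add_distrib] at h2
      rw [← h2]
      exact Finset.sum_congr rfl fun i _ => by ring
  have hz : a 0 = 0 := by
    have h3 : ∀ i, a (Fin.succ i) = 0 := fun i => congrFun htail i
    simp only [h3, mul_zero, Finset.sum_const_zero] at hcβ
    refine (mul_eq_zero.1 hcβ).resolve_left ?_
    rintro rfl
    exact hc0 (map_zero _)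
  ext1 i
  exact Fin.cases hz (fun i => congrFun htail i) i

/-- A family of polynomials linearly independent over the invariants has at most `|W|` members. -/
theorem le_card_of_linearIndependent_polyInvariants [Fintype W] {k : ℕ}
    {e : Fin k → MvPolynomial ι ℂ}
    (he : ∀ a : Fin k → MvPolynomial ι ℂ, (∀ i, a i ∈ polyInvariants b W) →
      ∑ i, a i * e i = 0 → a = 0) : k ≤ Fintype.card W := by
  classical
  let act (g : W) := pullback b ((g : U ≃ₗ[ℂ] U) : U →ₗ[ℂ] U)
  have hmul (g h : W) (f) : act h (act g f) = act (g * h) f := (pullback_mul _ _ f).symm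
  have hone (f) : act 1 f = f := pullback_id b f
  let M : (Fin k → MvPolynomial ι ℂ) →ₗ[MvPolynomial ι ℂ] (W → MvPolynomial ι ℂ) :=
    LinearMap.pi fun g => ∑ i, (act g (e i)) • LinearMap.proj i
  have hM : Function.Injective M := by
    refine (injective_iff_map_eq_zero M).2 fun c hc => ?_
    have hc' (g : W) : ∑ i, act g (e i) * c i = 0 := by
      simpa [M] using congrFun hc g
    by_contra hne
    obtain ⟨j, hj⟩ := Function.ne_iff.1 hne
    have hinj (h : W) : Function.Injective (act h) := by
      intro x y hxy
      have := congrArg (act h⁻¹) hxy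
      rwa [hmul, hmul, mul_inv_cancel, hone, hone] at this
    set B := ∏ h ∈ Finset.univ.erase (1 : W), act h (c j)
    have hB : c j * B = ∏ h, act h (c j) := by
      rw [← Finset.mul_prod_erase _ _ (Finset.mem_univ (1 : W)), hone]
    have hzero := he (fun i => ∑ h, act h (c i * B))
      (fun i => sum_pullback_mem_polyInvariants _) ?_
    · have hjz : ∑ h, act h (c j * B) = 0 := congrFun hzero j
      have hinv := prod_pullback_mem_polyInvariants (b := b) (W := W) (c j)
      have h4 (h : W) : act h (c j * B) = c j * B := by
        rw [hB]; exact hinv h h.2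
      simp only [h4, Finset.sum_const, nsmul_eq_mul, Finset.card_univ] at hjz
      refine (mul_ne_zero (Nat.cast_ne_zero.2 Fintype.card_ne_zero) ?_) hjz
      rw [hB]
      exact Finset.prod_ne_zero_iff.2 fun h _ => (map_ne_zero_iff _ (hinj h)).2 hj
    · simp only [Finset.sum_mul]
      rw [Finset.sum_comm]
      refine Finset.sum_eq_zero fun h _ => ?_
      have h5 := congrArg (fun f => act h f * act h B) (hc' h⁻¹)
      simp only [map_sum, map_mul, hmul, inv_mul_cancel, hone, map_zero, zero_mul,
        Finset.sum_mul] at h5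
      rw [← h5]
      exact Finset.sum_congr rfl fun i _ => by rw [map_mul]; ring
  simpa using card_le_of_injective (MvPolynomial ι ℂ) M hM

/-! ### Restriction to an orbit -/

variable (b W) in
/-- Restriction of polynomial functions to the orbit of `v`, parametrized by the group. -/
def orbitRestrict (v : U) : MvPolynomial ι ℂ →ₗ[ℂ] (W → ℂ) :=
  LinearMap.pi fun g => (evalAt b ((g : U ≃ₗ[ℂ] U) v)).toLinearMap

theorem orbitRestrict_apply (v : U) (f : MvPolynomial ι ℂ) (g : W) :
    orbitRestrict b W v f g = evalAt b ((g : U ≃ₗ[ℂ] U) v) f := rfl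

theorem orbitRestrict_surjective [Finite W] {v : U}
    (hv : Function.Injective fun g : W => (g : U ≃ₗ[ℂ] U) v) :
    Function.Surjective (orbitRestrict b W v) := by
  classical
  have := Fintype.ofFinite W
  have hsep (g h : W) (hgh : h ≠ g) : ∃ p : MvPolynomial ι ℂ,
      evalAt b ((g : U ≃ₗ[ℂ] U) v) p ≠ 0 ∧ evalAt b ((h : U ≃ₗ[ℂ] U) v) p = 0 := by
    obtain ⟨i, hi⟩ : ∃ i, b.coord i ((g : U ≃ₗ[ℂ] U) v) ≠ b.coord i ((h : U ≃ₗ[ℂ] U) v) := by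
      by_contra! hcon
      exact hgh (hv (b.ext_elem hcon)).symm
    refine ⟨X i - C (b.coord i ((h : U ≃ₗ[ℂ] U) v)), ?_, ?_⟩
    · simpa [evalAt, sub_eq_zero] using hi
    · simp [evalAt]
  choose! p hp hp' using hsep
  rw [← LinearMap.range_eq_top, eq_top_iff, ← (Pi.basisFun ℂ W).span_eq, Submodule.span_le]
  rintro _ ⟨g, rfl⟩
  set q := ∏ h ∈ Finset.univ.erase g, p g h
  have hq : evalAt b ((g : U ≃ₗ[ℂ] U) v) q ≠ 0 := by
    rw [map_prod]
    exact Finset.prod_ne_zero_iff.2 fun h hh => hp g h (Finset.ne_of_mem_erase hh)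
  refine ⟨(evalAt b ((g : U ≃ₗ[ℂ] U) v) q)⁻¹ • q, ?_⟩
  ext h
  rw [map_smul, Pi.smul_apply, orbitRestrict_apply, Pi.basisFun_apply, smul_eq_mul]
  rcases eq_or_ne h g with rfl | hne
  · rw [inv_mul_cancel₀ hq, Pi.single_eq_same]
  · have hq0 : evalAt b ((h : U ≃ₗ[ℂ] U) v) q = 0 := by
      rw [map_prod]
      exact Finset.prod_eq_zero (Finset.mem_erase.2 ⟨hne, Finset.mem_univ h⟩) (hp' g h hne)
    rw [Pi.single_eq_of_ne hne, hq0, mul_zero]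

/-- Homogeneous polynomials spanning modulo the Hilbert ideal span the functions on every orbit
obtained by restriction of polynomials. -/
theorem orbitRestrict_mem_span {κ : Type*} {e : κ → MvPolynomial ι ℂ}
    (hhom : ∀ i, ∃ n, (e i).IsHomogeneous n)
    (hspan : ∀ f, ∃ p ∈ Submodule.span ℂ (Set.range e), f - p ∈ hilbertIdeal b W)
    (v : U) (f : MvPolynomial ι ℂ) :
    orbitRestrict b W v f ∈ Submodule.span ℂ (Set.range (orbitRestrict b W v ∘ e)) := by
  set Q := Submodule.span ℂ (Set.range (orbitRestrict b W v ∘ e)) with hQ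
  have hmap : Q = (Submodule.span ℂ (Set.range e)).map (orbitRestrict b W v) := by
    rw [hQ, Submodule.map_span, Set.range_comp]
  have key (n : ℕ) : ∀ f : MvPolynomial ι ℂ, f.IsHomogeneous n → orbitRestrict b W v f ∈ Q := by
    induction n using Nat.strong_induction_on with
    | _ n ih =>
    have hI (h) (hh : h ∈ hilbertIdeal b W) :
        ∀ r, orbitRestrict b W v (homogeneousComponent n (r * h)) ∈ Q := by
      induction hh using Submodule.span_induction with
      | mem a ha =>
        obtain ⟨hinv, k, hk, hak⟩ := ha
        intro r
        rw [← sum_homogeneousComponent r, Finset.sum_mul, map_sum, map_sum]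
        refine Submodule.sum_mem _ fun j _ => ?_
        rw [homogeneousComponent_of_mem ((homogeneousComponent_isHomogeneous j r).mul hak)]
        split_ifs with hn
        · have : orbitRestrict b W v (homogeneousComponent j r * a) =
              evalAt b v a • orbitRestrict b W v (homogeneousComponent j r) := by
            ext g
            rw [Pi.smul_apply, orbitRestrict_apply, orbitRestrict_apply, map_mul, smul_eq_mul,
              mul_comm]
            conv_rhs => rw [← hinv g g.2, evalAt_pullback]
            rfl
          rw [this]
          exact Q.smul_mem _ (ih j (by omega) _ (homogeneousComponent_isHomogeneous j r))
        · rw [map_zero]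
          exact Q.zero_mem
      | zero => simp
      | add x y _ _ hx hy =>
        intro r
        rw [mul_add, map_add, map_add]
        exact Q.add_mem (hx r) (hy r)
      | smul s x _ hx =>
        intro r
        rw [smul_eq_mul, ← mul_assoc]
        exact hx _
    intro f hf
    obtain ⟨p, hp, hfp⟩ := hspan f
    have hpn : homogeneousComponent n p ∈ Submodule.span ℂ (Set.range e) := by
      have : Submodule.span ℂ (Set.range e) ≤
          (Submodule.span ℂ (Set.range e)).comap (homogeneousComponent n) := by
        rw [Submodule.span_le]
        rintro _ ⟨i, rfl⟩
        obtain ⟨m, hm⟩ := hhom i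
        rw [SetLike.mem_coe, Submodule.mem_comap, homogeneousComponent_of_mem hm]
        split_ifs
        · exact Submodule.subset_span ⟨i, rfl⟩
        · exact zero_mem _
      exact this hp
    have hsum : f = homogeneousComponent n p + homogeneousComponent n (1 * (f - p)) := by
      rw [one_mul, map_sub, homogeneousComponent_eq_self hf]
      ring
    rw [hsum, map_add]
    refine Q.add_mem ?_ (hI _ hfp 1)
    rw [hmap]
    exact Submodule.mem_map_of_mem hpn
  rw [← sum_homogeneousComponent f, map_sum]
  exact Submodule.sum_mem _ fun n _ => key n _ (homogeneousComponent_isHomogeneous n f)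

/-- For a reflection group `W` and an endomorphism `L` of finite order, there are at most `|W|`
eigenpolynomials of `L` whose restrictions to each regular orbit span all functions. -/
theorem exists_eigenpolynomials_span_eq_top [Fintype W] {R : Set (U ≃ₗ[ℂ] U)}
    (hR : Subgroup.closure R = W)
    (hrefl : ∀ r ∈ R, ∃ φ : U →ₗ[ℂ] ℂ, φ ≠ 0 ∧ ∃ a, ∀ x, r x = x + φ x • a)
    (L : U →ₗ[ℂ] U) {N : ℕ} (hN : 0 < N) (hL : L ^ N = 1) :
    ∃ k ≤ Fintype.card W, ∃ (e : Fin k → MvPolynomial ι ℂ) (c : Fin k → ℂ),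
      (∀ i, pullback b L (e i) = c i • e i) ∧
      ∀ v : U, Function.Injective (fun g : W => (g : U ≃ₗ[ℂ] U) v) →
        ⊤ ≤ Submodule.span ℂ (Set.range (orbitRestrict b W v ∘ e)) := by
  set π := (Ideal.Quotient.mkₐ ℂ (hilbertIdeal b W)).toLinearMap
  set E := {f : MvPolynomial ι ℂ | (∃ n, f.IsHomogeneous n) ∧ ∃ c : ℂ, pullback b L f = c • f}
  obtain ⟨κ, a, -, hsp, hli⟩ := exists_linearIndependent' ℂ (fun f : E => π f)
  have hbound {k : ℕ} (s : Fin k → κ) (hs : Function.Injective s) : k ≤ Fintype.card W :=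
    le_card_of_linearIndependent_polyInvariants (b := b)
      (e := fun i => (a (s i) : MvPolynomial ι ℂ))
      fun _ hx h => eq_zero_of_sum_mul_eq_zero hR hrefl (hli.comp s hs) hx h
  have : Finite κ := by
    by_contra hinf
    rw [not_finite_iff_infinite] at hinf
    have := hbound (fun i : Fin (Fintype.card W + 1) => Infinite.natEmbedding κ i)
      ((Infinite.natEmbedding κ).injective.comp Fin.val_injective)
    omega
  obtain ⟨k, ⟨ε⟩⟩ := Finite.exists_equiv_fin κ
  let e : Fin k → MvPolynomial ι ℂ := fun i => a (ε.symm i)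
  choose c hc using fun i => (a (ε.symm i)).2.2
  refine ⟨k, hbound ε.symm ε.symm.injective, e, c, hc, fun v hv φ _ => ?_⟩
  obtain ⟨f, rfl⟩ := orbitRestrict_surjective (b := b) hv φ
  refine orbitRestrict_mem_span (fun i => (a (ε.symm i)).2.1) (fun f => ?_) v f
  have h1 : π f ∈ (Submodule.span ℂ (Set.range e)).map π := by
    have hr : π '' Set.range e = Set.range ((fun f : E => π f) ∘ a) := by
      rw [← Set.range_comp]
      exact ε.symm.surjective.range_comp (fun x => π (a x))
    have hE : Set.range (fun f : E => π f) = π '' E := by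
      rw [Set.image_eq_range]
    rw [Submodule.map_span, hr, hsp, hE, ← Submodule.map_span,
      span_eigenpolynomials_eq_top b L hN hL]
    exact Submodule.mem_map_of_mem trivial
  obtain ⟨p, hp, hpf⟩ := h1
  exact ⟨p, hp, Ideal.Quotient.eq.1 hpf.symm⟩

end PolynomialFunctions

theorem trace_funLeft {α : Type*} [Fintype α] [DecidableEq α] (σ : α → α) :
    LinearMap.trace ℂ (α → ℂ) (LinearMap.funLeft ℂ ℂ σ) = Fintype.card {x // σ x = x} := by
  rw [LinearMap.trace_eq_matrix_trace ℂ (Pi.basisFun ℂ α), Matrix.trace, Fintype.card_subtype,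
    Finset.card_filter, Nat.cast_sum]
  refine Finset.sum_congr rfl fun x _ => ?_
  simp [LinearMap.funLeft_apply, Pi.single_apply]

/-- If a spanning family of at most `|α|` functions consists of eigenvectors of `φ ↦ φ ∘ σ`, then
the number of fixed points of `σ` is the sum of the eigenvalues. -/
theorem card_fixed_eq_sum_of_span {α : Type*} [Fintype α] [DecidableEq α] {σ : α → α} {k : ℕ}
    (hk : k ≤ Fintype.card α) {u : Fin k → α → ℂ} {c : Fin k → ℂ}
    (hu : ∀ i, u i ∘ σ = c i • u i) (hspan : ⊤ ≤ Submodule.span ℂ (Set.range u)) :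
    (Fintype.card {x // σ x = x} : ℂ) = ∑ i, c i := by
  have hk' : Fintype.card (Fin k) = finrank ℂ (α → ℂ) := by
    refine le_antisymm (by simpa using hk) ?_
    rw [← finrank_top, ← top_le_iff.1 hspan]
    exact finrank_range_le_card u
  let B := basisOfTopLeSpanOfCardEqFinrank u hspan hk'
  have hB (i) : B i = u i := by simp [B]
  rw [← trace_funLeft, LinearMap.trace_eq_matrix_trace ℂ B, Matrix.trace]
  refine Finset.sum_congr rfl fun i _ => ?_
  have : LinearMap.funLeft ℂ ℂ σ (B i) = c i • B i := by rw [hB]; exact hu i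
  rw [Matrix.diag_apply, LinearMap.toMatrix_apply, this]
  simp

theorem IsReflection.exists_eq_add_smul {r : V ≃ₗ[ℂ] V} (hr : IsReflection r) :
    ∃ φ : V →ₗ[ℂ] ℂ, φ ≠ 0 ∧ ∃ a, ∀ x, r x = x + φ x • a := by
  set D : V →ₗ[ℂ] V := (r : V →ₗ[ℂ] V) - LinearMap.id
  have h1 : finrank ℂ (LinearMap.range D) = 1 := by
    have h2 := D.finrank_range_add_finrank_ker
    have h3 : finrank ℂ (LinearMap.ker D) + 1 = finrank ℂ V := hr
    omega
  let ε : LinearMap.range D ≃ₗ[ℂ] ℂ := LinearEquiv.ofFinrankEq _ _ (by rw [h1, finrank_self])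
  refine ⟨ε.toLinearMap ∘ₗ D.rangeRestrict, fun h0 => ?_, ε.symm 1, fun x => ?_⟩
  · obtain ⟨x, hx⟩ := D.surjective_rangeRestrict (ε.symm 1)
    have := LinearMap.congr_fun h0 x
    simp [hx] at this
  · have h4 : ε (D.rangeRestrict x) • ε.symm 1 = D.rangeRestrict x := by
      rw [← map_smul, smul_eq_mul, mul_one, ε.symm_apply_apply]
    have h5 : ε (D.rangeRestrict x) • (ε.symm 1 : V) = D x := congrArg Subtype.val h4
    simp [h5, D]

/-- (Springer) Two elements of the complex reflection group `W` admitting a regular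
eigenvector for the same root of unity `ζ` are conjugate in `W`. -/
theorem stmt6 (W : Subgroup (V ≃ₗ[ℂ] V)) [Finite W]
    (hW : Subgroup.closure {g : V ≃ₗ[ℂ] V | g ∈ W ∧ IsReflection g} = W)
    (ζ : ℂ) (hζ : ∃ n : ℕ, 0 < n ∧ ζ ^ n = 1)
    (w w' : V ≃ₗ[ℂ] V) (hw : w ∈ W) (hw' : w' ∈ W)
    (v v' : V) (hv : v ∈ VReg W) (hv' : v' ∈ VReg W)
    (hwv : w v = ζ • v) (hw'v' : w' v' = ζ • v') :
    ∃ u ∈ W, u * w * u⁻¹ = w' := by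
  classical
  have := Fintype.ofFinite W
  obtain ⟨n, hn, hζn⟩ := hζ
  have hζ0 : ζ ≠ 0 := by
    rintro rfl
    rw [zero_pow hn.ne'] at hζn
    exact zero_ne_one hζn
  let L : V →ₗ[ℂ] V := ζ⁻¹ • (w' : V →ₗ[ℂ] V)
  have hL : L ^ (n * Fintype.card W) = 1 := by
    have hw1 : w' ^ Fintype.card W = 1 :=
      congrArg Subtype.val (pow_card_eq_one (x := (⟨w', hw'⟩ : W)))
    have hw2 : (w' : V →ₗ[ℂ] V) ^ Fintype.card W = 1 := by
      have := congrArg (LinearEquiv.automorphismGroup.toLinearMapMonoidHom (R := ℂ) (M := V)) hw1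
      rwa [map_pow, map_one] at this
    rw [smul_pow, inv_pow, pow_mul, hζn, one_pow, inv_one, one_smul, mul_comm, pow_mul, hw2,
      one_pow]
  obtain ⟨k, hk, e, c, hec, hspan⟩ := exists_eigenpolynomials_span_eq_top (b := finBasis ℂ V) hW
    (fun r hr => hr.2.exists_eq_add_smul) L (Nat.mul_pos hn Fintype.card_pos) hL
  have hinj {y : V} (hy : y ∈ VReg W) : Function.Injective fun g : W => (g : V ≃ₗ[ℂ] V) y := by
    intro g h hgh
    have h1 := hy (h⁻¹ * g : W) (h⁻¹ * g : W).2 ((LinearEquiv.symm_apply_eq _).2 hgh)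
    exact (inv_mul_eq_one.1 (Subtype.ext h1)).symm
  let σ (z g : W) : W := ⟨w', hw'⟩ * g * z⁻¹
  have hcount {z : W} {y : V} (hy : y ∈ VReg W) (hzy : (z : V ≃ₗ[ℂ] V) y = ζ • y) :
      (Fintype.card {g // σ z g = g} : ℂ) = ∑ i, c i := by
    refine card_fixed_eq_sum_of_span hk (fun i => ?_) (hspan y (hinj hy))
    have hz : (z⁻¹ : V ≃ₗ[ℂ] V) y = ζ⁻¹ • y := by
      refine (LinearEquiv.symm_apply_eq _).2 ?_
      rw [map_smul, hzy, inv_smul_smul₀ hζ0]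
    rw [Function.comp_apply, ← map_smul, ← hec]
    ext g
    have hσ : ((σ z g : W) : V ≃ₗ[ℂ] V) y = L ((g : V ≃ₗ[ℂ] V) y) := by
      change w' ((g : V ≃ₗ[ℂ] V) ((z⁻¹ : V ≃ₗ[ℂ] V) y)) = ζ⁻¹ • w' ((g : V ≃ₗ[ℂ] V) y)
      rw [hz, map_smul, map_smul]
    rw [Function.comp_apply, orbitRestrict_apply, orbitRestrict_apply, evalAt_pullback, hσ]
  have heq : Fintype.card {g // σ ⟨w, hw⟩ g = g} = Fintype.card {g // σ ⟨w', hw'⟩ g = g} := by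
    exact_mod_cast (hcount (z := ⟨w, hw⟩) hv hwv).trans (hcount (z := ⟨w', hw'⟩) hv' hw'v').symm
  have : Nonempty {g // σ ⟨w', hw'⟩ g = g} := ⟨1, by simp [σ]⟩
  obtain ⟨⟨g, hg⟩⟩ : Nonempty {g // σ ⟨w, hw⟩ g = g} := by
    rw [← Fintype.card_pos_iff, heq]
    exact Fintype.card_pos
  refine ⟨g, g.2, ?_⟩
  have h1 : w' * (g : V ≃ₗ[ℂ] V) * w⁻¹ = g := congrArg Subtype.val hg
  rw [mul_inv_eq_iff_eq_mul, ← mul_inv_eq_iff_eq_mul.1 h1]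
end
end

section
/- Let M be a finite-dimensional ℂW-module, let v ∈ V_reg, and let c : Ref(W) → ℂ be constant on W-conjugacy classes. Then the set E = {v* ∈ V* : M^{c,v,v*} ≠ 0} is finite and M decomposes as the internal direct sum M = ⊕_{v* ∈ E} M^{c,v,v*} of the joint generalized eigenspaces of the Gaudin operators. -/
open Module

noncomputable section

variable {V : Type*} [AddCommGroup V] [Module ℂ V] [FiniteDimensional ℂ V]

open Classical in
/-- The Gaudin operator `D_y^{c,v}` acting on a `ℂW`-module `M` through the
representation `ρ`. -/
def GaudinOp (W : Subgroup (V ≃ₗ[ℂ] V)) [Fintype W] {M : Type*} [AddCommGroup M]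
    [Module ℂ M] (ρ : Representation ℂ W M) (c : W → ℂ)
    (α : W → Module.Dual ℂ V) (v y : V) : Module.End ℂ M :=
  ∑ s : W, if IsReflection (s : V ≃ₗ[ℂ] V) then
    (LinearMap.det ((s : V ≃ₗ[ℂ] V) : V →ₗ[ℂ] V) * c s * (α s y / α s v)) • ρ s
  else 0

/-- The joint generalized eigenspace `M^{c,v,v*}` of a family of operators for the
system of eigenvalues given by the linear form `ξ`. -/
def jointGenEigenspace {M : Type*} [AddCommGroup M] [Module ℂ M]
    (D : V → Module.End ℂ M) (ξ : Module.Dual ℂ V) : Submodule ℂ M :=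
  ⨅ y : V, LinearMap.ker ((D y - ξ y • (1 : Module.End ℂ M)) ^ finrank ℂ M)

/-- The Hurwitz move `(s, t) ↦ (t, t⁻¹ s t)` on pairs of elements of a group satisfying a
conjugation-invariant predicate. -/
def hurwitzMove {G : Type*} [Group G] {P : G → Prop} (hP : ∀ g s, P s → P (g * s * g⁻¹)) :
    Equiv.Perm ({s // P s} × {s // P s}) where
  toFun p := (p.2, ⟨(p.2 : G)⁻¹ * p.1 * p.2, by simpa using hP (p.2 : G)⁻¹ p.1 p.1.2⟩)
  invFun p := (⟨(p.1 : G) * p.2 * (p.1 : G)⁻¹, hP p.1 p.2 p.2.2⟩, p.1)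
  left_inv p := by ext <;> simp [mul_assoc]
  right_inv p := by ext <;> simp [mul_assoc]

/-- Four linear forms normalised at `v` whose kernels contain a common subspace cut out by two of
them lie on an affine line, so that their wedge products satisfy a Chasles relation. -/
theorem wedge_eq_sub_of_ker_inf_le {K E : Type*} [Field K] [AddCommGroup E] [Module K E]
    {β₀ γ₀ β γ : Dual K E} {v : E}
    (hβ₀ : β₀ v = 1) (hγ₀ : γ₀ v = 1) (hβ : β v = 1) (hγ : γ v = 1)
    (h : LinearMap.ker β₀ ⊓ LinearMap.ker γ₀ ≤ LinearMap.ker β)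
    (h' : LinearMap.ker β₀ ⊓ LinearMap.ker γ₀ ≤ LinearMap.ker γ) (y z : E) :
    β y * γ z - β z * γ y = (β₀ y * γ z - β₀ z * γ y) - (β₀ y * β z - β₀ z * β y) := by
  have key : ∀ δ : Dual K E, δ v = 1 → LinearMap.ker β₀ ⊓ LinearMap.ker γ₀ ≤ LinearMap.ker δ →
      ∃ q : K, ∀ x, δ x = β₀ x + q * (γ₀ x - β₀ x) := by
    intro δ hδ hk
    have hmem : δ ∈ Submodule.span K (Set.range ![β₀, γ₀]) := by
      apply mem_span_of_iInf_ker_le_ker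
      intro x hx
      apply hk
      simpa [Submodule.mem_iInf, Fin.forall_fin_two] using hx
    obtain ⟨a, ha⟩ := (Submodule.mem_span_range_iff_exists_fun K).1 hmem
    have hx : ∀ x, δ x = a 0 * β₀ x + a 1 * γ₀ x := by
      intro x
      rw [← ha]
      simp [Fin.sum_univ_two]
    have hv := hx v
    rw [hδ, hβ₀, hγ₀] at hv
    refine ⟨a 1, fun x => ?_⟩
    rw [hx x]
    linear_combination -(β₀ x) * hv
  obtain ⟨p, hp⟩ := key β hβ h
  obtain ⟨q, hq⟩ := key γ hγ h'
  simp only [hp, hq]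
  ring

/-- Conjugation-invariantly weighted sums of group elements twisted by linear forms normalised at
`v`, whose kernels are the fixed spaces, commute. -/
theorem commute_sum_smul_of_ker_eq_fixed {K G E A : Type*} [Field K] [Group G]
    [AddCommGroup E] [Module K E] [Ring A] [Algebra K A]
    (τ : G →* (E ≃ₗ[K] E)) (ρ : G →* A)
    {P : G → Prop} [Fintype {s // P s}] (hP : ∀ g s, P s → P (g * s * g⁻¹))
    (k : G → K) (hk : ∀ g s, P s → k (g * s * g⁻¹) = k s)
    (β : G → Dual K E) (v : E) (hv : ∀ s, P s → β s v = 1)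
    (hβ : ∀ s, P s → ∀ x, β s x = 0 ↔ τ s x = x) (y z : E) :
    Commute (∑ s : {s // P s}, (k s * β s y) • ρ s) (∑ s : {s // P s}, (k s * β s z) • ρ s) := by
  let R := {s // P s}
  let U : R × R → Submodule K E := fun p => LinearMap.ker (β p.1) ⊓ LinearMap.ker (β p.2)
  have hU : ∀ p, U (hurwitzMove hP p) = U p := by
    rintro ⟨⟨s, hs⟩, ⟨t, ht⟩⟩
    ext x
    have hc : P (t⁻¹ * s * t) := by simpa using hP t⁻¹ s hs
    simp only [U, hurwitzMove, Equiv.coe_fn_mk, Submodule.mem_inf, LinearMap.mem_ker,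
      hβ _ hs, hβ _ ht, hβ _ hc, map_mul, LinearEquiv.mul_apply, map_inv]
    have hinv : ∀ a b : E, (τ t)⁻¹ a = b ↔ a = τ t b := fun a b =>
      (τ t).symm_apply_eq
    rw [hinv]
    constructor
    · rintro ⟨h1, h2⟩
      rw [h1] at h2
      exact ⟨h2, h1⟩
    · rintro ⟨h1, h2⟩
      exact ⟨h2, by rw [h2, h1]⟩
  cases isEmpty_or_nonempty R with
  | inl h => simp [Commute, SemiconjBy]
  | inr h =>
  let rep : R × R → R × R := fun p => Function.invFun U (U p)
  have hrep : ∀ p, U (rep p) = U p := fun p => Function.invFun_eq ⟨p, rfl⟩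
  let F : R × R → A := fun p => (k p.1 * k p.2 *
    (β (rep p).1 y * β p.1 z - β (rep p).1 z * β p.1 y)) • ρ (p.1 * p.2)
  have hF : ∀ p, F (hurwitzMove hP p) - F p =
      ((k p.1 * β p.1 y) * (k p.2 * β p.2 z) - (k p.1 * β p.1 z) * (k p.2 * β p.2 y)) •
        ρ (p.1 * p.2) := by
    intro p
    have h1 : rep (hurwitzMove hP p) = rep p := by simp only [rep, hU]
    have h2 : k ((p.2 : G)⁻¹ * p.1 * p.2) = k p.1 := by
      simpa using hk (p.2 : G)⁻¹ p.1 p.1.2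
    have h3 : (p.2 : G) * ((p.2 : G)⁻¹ * p.1 * p.2) = p.1 * p.2 := by group
    have hw := wedge_eq_sub_of_ker_inf_le (hv _ (rep p).1.2) (hv _ (rep p).2.2) (hv _ p.1.2)
      (hv _ p.2.2) ((hrep p).le.trans inf_le_left) ((hrep p).le.trans inf_le_right) y z
    simp only [F, h1]
    simp only [hurwitzMove, Equiv.coe_fn_mk, h2, h3]
    rw [← sub_smul]
    congr 1
    linear_combination -(k p.1 * k p.2) * hw
  have hsum : ∑ p, (F (hurwitzMove hP p) - F p) = 0 := by
    rw [Finset.sum_sub_distrib, Equiv.sum_comp, sub_self]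
  simp only [hF, sub_smul, Finset.sum_sub_distrib, sub_eq_zero] at hsum
  have hmul : ∀ a b : E, (∑ s : R, (k s * β s a) • ρ s) * (∑ s : R, (k s * β s b) • ρ s) =
      ∑ p : R × R, ((k p.1 * β p.1 a) * (k p.2 * β p.2 b)) • ρ (p.1 * p.2) := by
    intro a b
    rw [Finset.sum_mul_sum, Fintype.sum_prod_type]
    simp only [smul_mul_smul_comm, map_mul]
  exact (hmul y z).trans (hsum.trans (hmul z y).symm)

theorem IsReflection.conj {V : Type*} [AddCommGroup V] [Module ℂ V] {s : V ≃ₗ[ℂ] V} (hs : IsReflection s) (g : V ≃ₗ[ℂ] V) :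
    IsReflection (g * s * g⁻¹) := by
  have h : LinearMap.ker (((g * s * g⁻¹ : V ≃ₗ[ℂ] V) : V →ₗ[ℂ] V) - LinearMap.id) =
      (LinearMap.ker ((s : V →ₗ[ℂ] V) - LinearMap.id)).map (g : V →ₗ[ℂ] V) := by
    ext x
    rw [Submodule.mem_map_equiv]
    simp only [LinearMap.mem_ker, LinearMap.sub_apply, sub_eq_zero]
    change g (s (g.symm x)) = x ↔ s (g.symm x) = g.symm x
    rw [LinearEquiv.eq_symm_apply]
  unfold IsReflection
  rw [h, LinearEquiv.finrank_map_eq]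
  exact hs

/-- Generalized joint eigenspaces of a commuting family of operators depending linearly on a
parameter: finitely many linear forms occur, and the space is their direct sum. -/
theorem jointGenEigenspace_decomposition {V : Type*} [AddCommGroup V] [Module ℂ V]
    {M : Type*} [AddCommGroup M] [Module ℂ M]
    [FiniteDimensional ℂ M] (D : V →ₗ[ℂ] Module.End ℂ M) (hD : ∀ y z, Commute (D y) (D z)) :
    {ξ : Dual ℂ V | jointGenEigenspace D ξ ≠ ⊥}.Finite ∧
    iSupIndep (fun ξ : {ξ : Dual ℂ V | jointGenEigenspace D ξ ≠ ⊥} => jointGenEigenspace D ξ) ∧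
    (⨆ ξ : {ξ : Dual ℂ V | jointGenEigenspace D ξ ≠ ⊥}, jointGenEigenspace D ξ) = ⊤ := by
  have hJ : ∀ ξ : Dual ℂ V, jointGenEigenspace D ξ = ⨅ y, (D y).maxGenEigenspace (ξ y) := by
    intro ξ
    simp only [jointGenEigenspace, End.maxGenEigenspace_eq_genEigenspace_finrank,
      End.genEigenspace_nat]
  have hmaps : ∀ i j φ, Set.MapsTo (D i) ((D j).maxGenEigenspace φ) ((D j).maxGenEigenspace φ) :=
    fun i j φ => End.mapsTo_maxGenEigenspace_of_comm (hD j i) φ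
  have hind : iSupIndep fun ξ : Dual ℂ V => jointGenEigenspace D ξ := by
    simp only [hJ]
    exact (End.independent_iInf_maxGenEigenspace_of_forall_mapsTo D hmaps).comp
      (f := fun ξ : Dual ℂ V => (ξ : V → ℂ)) DFunLike.coe_injective
  refine ⟨WellFoundedGT.finite_ne_bot_of_iSupIndep hind, hind.comp Subtype.val_injective, ?_⟩
  rw [eq_top_iff, ← End.iSup_iInf_maxGenEigenspace_eq_top_of_forall_mapsTo D hmaps
    fun y => End.iSup_maxGenEigenspace_eq_top (D y)]
  refine iSup_le fun χ => ?_
  by_cases hχ : ⨅ y, (D y).maxGenEigenspace (χ y) = ⊥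
  · simp [hχ]
  let ξ : Dual ℂ V :=
    { toFun := χ
      map_add' := End.map_add_of_iInf_genEigenspace_ne_bot_of_commute D χ ⊤ hχ hD
      map_smul' := End.map_smul_of_iInf_genEigenspace_ne_bot D χ ⊤ hχ }
  have hξ : jointGenEigenspace D ξ = ⨅ y, (D y).maxGenEigenspace (χ y) := hJ ξ
  rw [← hξ] at hχ ⊢
  exact le_iSup (fun ξ : {ξ : Dual ℂ V | jointGenEigenspace D ξ ≠ ⊥} =>
    jointGenEigenspace D (ξ : Dual ℂ V)) ⟨ξ, hχ⟩

/-- A finite-dimensional `ℂW`-module decomposes as the internal direct sum of the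
(finitely many nonzero) joint generalized eigenspaces of the Gaudin operators. -/
theorem stmt9 (W : Subgroup (V ≃ₗ[ℂ] V)) [Fintype W]
    (hW : Subgroup.closure {g : V ≃ₗ[ℂ] V | g ∈ W ∧ IsReflection g} = W)
    (α : W → Module.Dual ℂ V)
    (hα : ∀ s : W, IsReflection (s : V ≃ₗ[ℂ] V) →
      LinearMap.ker (α s) = LinearMap.ker (((s : V ≃ₗ[ℂ] V) : V →ₗ[ℂ] V) - LinearMap.id))
    (c : W → ℂ)
    (hc : ∀ s w : W, IsReflection (s : V ≃ₗ[ℂ] V) → c (w * s * w⁻¹) = c s)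
    (v : V) (hv : v ∈ VReg W)
    {M : Type*} [AddCommGroup M] [Module ℂ M] [FiniteDimensional ℂ M]
    (ρ : Representation ℂ W M) :
    {ξ : Module.Dual ℂ V | jointGenEigenspace (GaudinOp W ρ c α v) ξ ≠ ⊥}.Finite ∧
    iSupIndep (fun ξ : {ξ : Module.Dual ℂ V | jointGenEigenspace (GaudinOp W ρ c α v) ξ ≠ ⊥} =>
      jointGenEigenspace (GaudinOp W ρ c α v) ξ) ∧
    (⨆ ξ : {ξ : Module.Dual ℂ V | jointGenEigenspace (GaudinOp W ρ c α v) ξ ≠ ⊥},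
      jointGenEigenspace (GaudinOp W ρ c α v) ξ) = ⊤ := by
  classical
  have hα0 : ∀ s : W, IsReflection (s : V ≃ₗ[ℂ] V) → α s v ≠ 0 := by
    intro s hs h0
    have hmem : v ∈ LinearMap.ker (α s) := h0
    rw [hα s hs, LinearMap.mem_ker, LinearMap.sub_apply, sub_eq_zero] at hmem
    have h1 : (s : V ≃ₗ[ℂ] V) = 1 := hv s s.2 hmem
    rw [h1] at hs
    have hker : LinearMap.ker (((1 : V ≃ₗ[ℂ] V) : V →ₗ[ℂ] V) - LinearMap.id) = ⊤ := by
      ext x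
      simp
    rw [IsReflection, hker, finrank_top] at hs
    omega
  let P : W → Prop := fun s => IsReflection (s : V ≃ₗ[ℂ] V)
  let k : W → ℂ := fun s => LinearMap.det ((s : V ≃ₗ[ℂ] V) : V →ₗ[ℂ] V) * c s
  let β : W → Dual ℂ V := fun s => (α s v)⁻¹ • α s
  have hG : ∀ y, GaudinOp W ρ c α v y = ∑ s : {s // P s}, (k s * β s y) • ρ s := by
    intro y
    rw [GaudinOp, ← Finset.sum_filter, ← Finset.sum_subtype_eq_sum_filter]
    refine Finset.sum_bij' (fun s _ => ⟨s.1, s.2⟩) (fun s _ => ⟨s.1, s.2⟩) ?_ ?_ ?_ ?_ ?_ <;>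
      simp [k, β, div_eq_inv_mul]
  let D : V →ₗ[ℂ] Module.End ℂ M :=
    { toFun := GaudinOp W ρ c α v
      map_add' := fun x y => by
        simp only [hG, map_add, mul_add, add_smul, Finset.sum_add_distrib]
      map_smul' := fun a x => by
        simp only [hG, map_smul, smul_eq_mul, Finset.smul_sum, smul_smul, RingHom.id_apply,
          mul_left_comm] }
  refine jointGenEigenspace_decomposition D fun y z => ?_
  change Commute (GaudinOp W ρ c α v y) (GaudinOp W ρ c α v z)
  rw [hG, hG]
  refine commute_sum_smul_of_ker_eq_fixed W.subtype ρ (P := P) (fun g s hs => hs.conj g) k ?_ β v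
    ?_ ?_ y z
  · intro g s hs
    simp only [k, hc s g hs]
    congr 1
    exact LinearMap.det_conj ((s : V ≃ₗ[ℂ] V) : V →ₗ[ℂ] V) (g : V ≃ₗ[ℂ] V)
  · intro s hs
    simp [β, hα0 s hs]
  · intro s hs x
    have hx : α s x = 0 ↔ (s : V ≃ₗ[ℂ] V) x = x := by
      rw [← LinearMap.mem_ker, hα s hs, LinearMap.mem_ker, LinearMap.sub_apply, sub_eq_zero]
      rfl
    simpa [β, hα0 s hs] using hx
end
end
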